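/- arXiv:2207.03476 — 2 statements merged into one kernel-verified Lean document; each statement's English description precedes it below -/
import Mathlib

section
/- Let α ∈ (1/3, 1/2], γ ∈ (α, 2α], g : [0,1] → ℝ^{d₀}, f : [0,1] → ℝ^n and f' : [0,1] → ℝ^{n×d₀}. Then for any k ≥ 1 and any points 0 ≤ u₀ ≤ u₁ ≤ ⋯ ≤ u_k ≤ 1, [(f,f')]_{D^γ_g([u₀,u_k])} ≤ Σ_{i=1}^{k} [(f,f')]_{D^γ_g([u_{i−1},u_i])} + Σ_{i=1}^{k−1} [f']_{C^{γ−α}([u_{i−1},u_i])} [g]_{C^α([u_i,u_k])}. -/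
open scoped ENNReal

/-- Frobenius (Euclidean) norm of a real matrix. -/
noncomputable def frobNorm {m n : ℕ} (M : Matrix (Fin m) (Fin n) ℝ) : ℝ :=
  Real.sqrt (∑ i, ∑ j, (M i j) ^ 2)

/-- Reinterpret a plain vector `ℝ^d` as a point of Euclidean space. -/
noncomputable def toEuc {d : ℕ} (v : Fin d → ℝ) : EuclideanSpace ℝ (Fin d) :=
  (WithLp.equiv 2 (Fin d → ℝ)).symm v

/-- Hölder seminorm `[h]_{C^β([s,t])}` of a vector-valued path (with value in
`[0,∞]`). -/
noncomputable def holderSemiE {E : Type*} [NormedAddCommGroup E] (β : ℝ)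
    (h : ℝ → E) (s t : ℝ) : ℝ≥0∞ :=
  ⨆ (u : ℝ) (v : ℝ) (_ : s ≤ u ∧ u < v ∧ v ≤ t),
    ENNReal.ofReal (‖h v - h u‖ / (v - u) ^ β)

/-- Hölder seminorm `[h]_{C^β([s,t])}` of a matrix-valued path, with respect to
the Frobenius norm (with value in `[0,∞]`). -/
noncomputable def holderSemiMat {m n : ℕ} (β : ℝ)
    (h : ℝ → Matrix (Fin m) (Fin n) ℝ) (s t : ℝ) : ℝ≥0∞ :=
  ⨆ (u : ℝ) (v : ℝ) (_ : s ≤ u ∧ u < v ∧ v ≤ t),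
    ENNReal.ofReal (frobNorm (h v - h u) / (v - u) ^ β)

/-- Controlled-path seminorm
`[(f,f')]_{D^γ_g([s,t])} = sup_{s ≤ u < v ≤ t} |f(v)-f(u)-f'(u)(g(v)-g(u))|/(v-u)^γ
  + [f']_{C^{γ-α}([s,t])}` (with value in `[0,∞]`). -/
noncomputable def ctrlSemi {d₀ n : ℕ} (γ α : ℝ)
    (g : ℝ → EuclideanSpace ℝ (Fin d₀)) (f : ℝ → EuclideanSpace ℝ (Fin n))
    (f' : ℝ → Matrix (Fin n) (Fin d₀) ℝ) (s t : ℝ) : ℝ≥0∞ :=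
  (⨆ (u : ℝ) (v : ℝ) (_ : s ≤ u ∧ u < v ∧ v ≤ t),
    ENNReal.ofReal (‖f v - f u - toEuc ((f' u).mulVec (g v - g u))‖ / (v - u) ^ γ))
    + holderSemiMat (γ - α) f' s t

/-- The supremum of `F u v / (v - u) ^ β` over `s ≤ u < v ≤ t`. -/
noncomputable def incrementSemi (β : ℝ) (F : ℝ → ℝ → ℝ) (s t : ℝ) : ℝ≥0∞ :=
  ⨆ (u : ℝ) (v : ℝ) (_ : s ≤ u ∧ u < v ∧ v ≤ t), ENNReal.ofReal (F u v / (v - u) ^ β)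

lemma ofReal_le_incrementSemi_mul {β : ℝ} {F : ℝ → ℝ → ℝ} {s t u v : ℝ} (hF : F u u = 0)
    (hsu : s ≤ u) (huv : u ≤ v) (hvt : v ≤ t) :
    ENNReal.ofReal (F u v) ≤ incrementSemi β F s t * ENNReal.ofReal ((v - u) ^ β) := by
  rcases huv.eq_or_lt with rfl | huv
  · simp [hF]
  have hpos : 0 < (v - u) ^ β := Real.rpow_pos_of_pos (sub_pos.2 huv) β
  calc ENNReal.ofReal (F u v)
      = ENNReal.ofReal (F u v / (v - u) ^ β) * ENNReal.ofReal ((v - u) ^ β) := by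
        rw [← ENNReal.ofReal_mul' hpos.le, div_mul_cancel₀ _ hpos.ne']
    _ ≤ _ := by
        gcongr
        exact le_iSup₂_of_le u v (le_iSup_of_le ⟨hsu, huv, hvt⟩ le_rfl)

lemma incrementSemi_le {β : ℝ} {F : ℝ → ℝ → ℝ} {s t : ℝ} {C : ℝ≥0∞}
    (h : ∀ u v, s ≤ u → u < v → v ≤ t →
      ENNReal.ofReal (F u v) ≤ C * ENNReal.ofReal ((v - u) ^ β)) :
    incrementSemi β F s t ≤ C := by
  refine iSup₂_le fun u v => iSup_le fun ⟨hsu, huv, hvt⟩ => ?_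
  rw [ENNReal.ofReal_div_of_pos (Real.rpow_pos_of_pos (sub_pos.2 huv) β)]
  exact ENNReal.div_le_of_le_mul (h u v hsu huv hvt)

/-- Approximate subadditivity of increments at `b` passes to the seminorms. -/
lemma incrementSemi_le_add {β : ℝ} (hβ : 0 ≤ β) {F G : ℝ → ℝ → ℝ} {a b c : ℝ} {M : ℝ≥0∞}
    (hF : ∀ u, F u u = 0)
    (hadd : ∀ s t, F s t ≤ F s b + F b t + G s t)
    (hG : ∀ s t, a ≤ s → s ≤ b → b ≤ t → t ≤ c →
      ENNReal.ofReal (G s t) ≤ M * ENNReal.ofReal ((t - s) ^ β)) :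
    incrementSemi β F a c ≤ incrementSemi β F a b + incrementSemi β F b c + M := by
  refine incrementSemi_le fun s t has hst htc => ?_
  rcases le_total t b with htb | hbt
  · refine (ofReal_le_incrementSemi_mul (β := β) (hF s) has hst.le htb).trans ?_
    gcongr
    rw [add_assoc]
    exact le_self_add
  rcases le_total b s with hbs | hsb
  · refine (ofReal_le_incrementSemi_mul (β := β) (hF s) hbs hst.le htc).trans ?_
    gcongr
    exact le_add_self.trans le_self_add
  calc ENNReal.ofReal (F s t)
      ≤ ENNReal.ofReal (F s b + F b t + G s t) := ENNReal.ofReal_le_ofReal (hadd s t)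
    _ ≤ ENNReal.ofReal (F s b) + ENNReal.ofReal (F b t) + ENNReal.ofReal (G s t) :=
        ENNReal.ofReal_add_le.trans (by gcongr; exact ENNReal.ofReal_add_le)
    _ ≤ incrementSemi β F a b * ENNReal.ofReal ((b - s) ^ β)
          + incrementSemi β F b c * ENNReal.ofReal ((t - b) ^ β)
          + M * ENNReal.ofReal ((t - s) ^ β) := by
        gcongr
        · exact ofReal_le_incrementSemi_mul (hF s) has hsb le_rfl
        · exact ofReal_le_incrementSemi_mul (hF b) le_rfl hbt htc
        · exact hG s t has hsb hbt htc
    _ ≤ _ := by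
        rw [add_mul, add_mul]
        gcongr

section Frobenius

attribute [local instance] Matrix.frobeniusNormedAddCommGroup

lemma frobNorm_eq_norm {m n : ℕ} (M : Matrix (Fin m) (Fin n) ℝ) : frobNorm M = ‖M‖ := by
  rw [Matrix.frobenius_norm_def, frobNorm, Real.sqrt_eq_rpow]
  simp

lemma frobNorm_add_le {m n : ℕ} (M N : Matrix (Fin m) (Fin n) ℝ) :
    frobNorm (M + N) ≤ frobNorm M + frobNorm N := by
  simpa only [frobNorm_eq_norm] using norm_add_le M N

lemma norm_toEuc_mulVec_le {m n : ℕ} (M : Matrix (Fin m) (Fin n) ℝ)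
    (v : EuclideanSpace ℝ (Fin n)) : ‖toEuc (M.mulVec v)‖ ≤ frobNorm M * ‖v‖ := by
  have h := Matrix.frobenius_norm_mul M (Matrix.replicateCol Unit (v : Fin n → ℝ))
  rw [← Matrix.replicateCol_mulVec, Matrix.frobenius_norm_replicateCol,
    Matrix.frobenius_norm_replicateCol, ← frobNorm_eq_norm] at h
  exact h

end Frobenius

@[simp] lemma frobNorm_zero {m n : ℕ} : frobNorm (0 : Matrix (Fin m) (Fin n) ℝ) = 0 := by
  simp [frobNorm]

lemma frobNorm_nonneg {m n : ℕ} (M : Matrix (Fin m) (Fin n) ℝ) : 0 ≤ frobNorm M :=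
  Real.sqrt_nonneg _

lemma toEuc_zero {d : ℕ} : toEuc (0 : Fin d → ℝ) = 0 := rfl

lemma toEuc_add {d : ℕ} (v w : Fin d → ℝ) : toEuc (v + w) = toEuc v + toEuc w := rfl

lemma holderSemiMat_le_add {m n : ℕ} {β : ℝ} (hβ : 0 ≤ β) (h : ℝ → Matrix (Fin m) (Fin n) ℝ)
    (a b c : ℝ) :
    holderSemiMat β h a c ≤ holderSemiMat β h a b + holderSemiMat β h b c := by
  have key := incrementSemi_le_add hβ (F := fun u v => frobNorm (h v - h u)) (G := fun _ _ => 0)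
    (a := a) (b := b) (c := c) (M := 0) (by simp)
    (fun s t => by
      simpa [add_comm] using frobNorm_add_le (h t - h b) (h b - h s))
    (by simp)
  rwa [add_zero] at key

lemma remainder_norm_le {d n : ℕ} (g : ℝ → EuclideanSpace ℝ (Fin d))
    (f : ℝ → EuclideanSpace ℝ (Fin n)) (f' : ℝ → Matrix (Fin n) (Fin d) ℝ) (s b t : ℝ) :
    ‖f t - f s - toEuc ((f' s).mulVec (g t - g s))‖
      ≤ ‖f b - f s - toEuc ((f' s).mulVec (g b - g s))‖
        + ‖f t - f b - toEuc ((f' b).mulVec (g t - g b))‖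
        + frobNorm (f' b - f' s) * ‖g t - g b‖ := by
  have h₁ : toEuc ((f' s).mulVec (g t - g s))
      = toEuc ((f' s).mulVec (g b - g s)) + toEuc ((f' s).mulVec (g t - g b)) := by
    rw [← toEuc_add, ← Matrix.mulVec_add]
    simp
  have h₂ : toEuc ((f' b).mulVec (g t - g b))
      = toEuc ((f' b - f' s).mulVec (g t - g b)) + toEuc ((f' s).mulVec (g t - g b)) := by
    rw [← toEuc_add, ← Matrix.add_mulVec, sub_add_cancel]
  have h₃ : f t - f s - toEuc ((f' s).mulVec (g t - g s))
      = (f b - f s - toEuc ((f' s).mulVec (g b - g s)))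
        + (f t - f b - toEuc ((f' b).mulVec (g t - g b)))
        + toEuc ((f' b - f' s).mulVec (g t - g b)) := by
    rw [h₁, h₂]
    abel
  rw [h₃]
  refine norm_add₃_le.trans ?_
  gcongr
  exact norm_toEuc_mulVec_le (f' b - f' s) (g t - g b)

lemma ctrlSemi_le_add {d n : ℕ} {α γ : ℝ} (hα : 0 ≤ α) (hγ : α ≤ γ)
    (g : ℝ → EuclideanSpace ℝ (Fin d)) (f : ℝ → EuclideanSpace ℝ (Fin n))
    (f' : ℝ → Matrix (Fin n) (Fin d) ℝ) (a b c : ℝ) :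
    ctrlSemi γ α g f f' a c ≤ ctrlSemi γ α g f f' a b + ctrlSemi γ α g f f' b c
      + holderSemiMat (γ - α) f' a b * holderSemiE α g b c := by
  have hR := incrementSemi_le_add (hα.trans hγ)
    (F := fun u v => ‖f v - f u - toEuc ((f' u).mulVec (g v - g u))‖)
    (G := fun s t => frobNorm (f' b - f' s) * ‖g t - g b‖)
    (a := a) (b := b) (c := c) (M := holderSemiMat (γ - α) f' a b * holderSemiE α g b c)
    (by simp [toEuc_zero])
    (fun s t => remainder_norm_le g f f' s b t)
    (fun s t has hsb hbt htc => by
      have h₁ : ENNReal.ofReal (frobNorm (f' b - f' s))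
          ≤ holderSemiMat (γ - α) f' a b * ENNReal.ofReal ((b - s) ^ (γ - α)) :=
        ofReal_le_incrementSemi_mul (F := fun u v => frobNorm (f' v - f' u)) (by simp)
          has hsb le_rfl
      have h₂ : ENNReal.ofReal ‖g t - g b‖
          ≤ holderSemiE α g b c * ENNReal.ofReal ((t - b) ^ α) :=
        ofReal_le_incrementSemi_mul (F := fun u v => ‖g v - g u‖) (by simp) le_rfl hbt htc
      have hγα : 0 ≤ γ - α := sub_nonneg.2 hγ
      have hpow : (b - s) ^ (γ - α) * (t - b) ^ α ≤ (t - s) ^ γ := by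
        have hbs : 0 ≤ b - s := sub_nonneg.2 hsb
        have htb : 0 ≤ t - b := sub_nonneg.2 hbt
        have hts : 0 ≤ t - s := sub_nonneg.2 (hsb.trans hbt)
        calc (b - s) ^ (γ - α) * (t - b) ^ α
            ≤ (t - s) ^ (γ - α) * (t - s) ^ α := by gcongr
          _ = (t - s) ^ γ := by
            rw [← Real.rpow_add_of_nonneg hts hγα hα, sub_add_cancel]
      rw [ENNReal.ofReal_mul (frobNorm_nonneg _)]
      refine (mul_le_mul' h₁ h₂).trans ?_
      rw [mul_mul_mul_comm, ← ENNReal.ofReal_mul (Real.rpow_nonneg (sub_nonneg.2 hsb) _)]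
      gcongr)
  refine (add_le_add hR (holderSemiMat_le_add (sub_nonneg.2 hγ) f' a b c)).trans_eq ?_
  simp only [ctrlSemi, incrementSemi]
  ring

/-- Subadditivity of the controlled seminorm along a partition
(equation `eq:sum_partition`): for `0 ≤ u₀ ≤ u₁ ≤ ⋯ ≤ u_k ≤ 1`,
`[(f,f')]_{D^γ_g([u₀,u_k])} ≤ Σ_{i=1}^k [(f,f')]_{D^γ_g([u_{i-1},u_i])}
  + Σ_{i=1}^{k-1} [f']_{C^{γ-α}([u_{i-1},u_i])} [g]_{C^α([u_i,u_k])}`. -/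
theorem ctrl_seminorm_partition
    (d₀ n : ℕ) (α γ : ℝ) (hα : 1 / 3 < α ∧ α ≤ 1 / 2) (hγ : α < γ ∧ γ ≤ 2 * α)
    (g : ℝ → EuclideanSpace ℝ (Fin d₀)) (f : ℝ → EuclideanSpace ℝ (Fin n))
    (f' : ℝ → Matrix (Fin n) (Fin d₀) ℝ)
    (k : ℕ) (hk : 1 ≤ k) (u : ℕ → ℝ)
    (hu0 : 0 ≤ u 0) (hmono : ∀ i < k, u i ≤ u (i + 1)) (huk : u k ≤ 1) :
    ctrlSemi γ α g f f' (u 0) (u k)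
      ≤ (∑ i ∈ Finset.range k, ctrlSemi γ α g f f' (u i) (u (i + 1)))
        + ∑ i ∈ Finset.range (k - 1),
            holderSemiMat (γ - α) f' (u i) (u (i + 1))
              * holderSemiE α g (u (i + 1)) (u k) := by
  induction k, hk using Nat.le_induction generalizing u with
  | base => simp
  | succ k hk ih =>
    obtain ⟨m, rfl⟩ := Nat.exists_eq_add_of_le' hk
    have ih' := ih (fun i => u (i + 1)) (hu0.trans (hmono 0 (by omega)))
      (fun i hi => hmono (i + 1) (by omega)) huk
    refine (ctrlSemi_le_add (by linarith [hα.1]) hγ.1.le g f f' (u 0) (u 1) _).trans ?_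
    simp only [Nat.add_sub_cancel] at ih' ⊢
    rw [Finset.sum_range_succ' (fun i => ctrlSemi γ α g f f' (u i) (u (i + 1))) (m + 1),
      Finset.sum_range_succ' (fun i => holderSemiMat (γ - α) f' (u i) (u (i + 1)) * _) m]
    refine (add_le_add (add_le_add le_rfl ih') le_rfl).trans_eq ?_
    simp only [zero_add]
    ring
end

section
/- Let θ > θ' > 0, let p ≥ 1 satisfy (θ − θ')p > 1, and let C ≥ 0. Let Z_{n,i}, for n ∈ ℕ and 1 ≤ i ≤ 2ⁿ, be real-valued random variables on a probability space with E|Z_{n,i}|^p ≤ C^p 2^{−nθp} for all n, i. Then the random variable ξ := sup_{n∈ℕ} max_{1 ≤ i ≤ 2ⁿ} 2^{nθ'} |Z_{n,i}| satisfies E ξ^p ≤ C^p (1 − 2^{1−(θ−θ')p})^{−1}; in particular ξ is almost surely finite. -/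
open MeasureTheory
open scoped ENNReal

/-- A supremum of extended nonnegative reals, raised to a positive power, is at most the sum of the
powers. -/
lemma iSup_rpow_le_tsum_sum_rpow {p : ℝ} (hp : 0 < p) (s : ℕ → Finset ℕ) (q : ℕ → ℕ → Prop)
    (hq : ∀ n i, q n i → i ∈ s n) (a : ℕ → ℕ → ℝ≥0∞) :
    (⨆ (n : ℕ) (i : ℕ) (_ : q n i), a n i) ^ p ≤ ∑' n, ∑ i ∈ s n, a n i ^ p := by
  rw [← ENNReal.le_rpow_inv_iff hp]
  refine iSup_le fun n => iSup_le fun i => iSup_le fun h => ?_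
  rw [ENNReal.le_rpow_inv_iff hp]
  exact (Finset.single_le_sum (f := fun i => a n i ^ p) (fun _ _ => zero_le) (hq n i h)).trans
    (ENNReal.le_tsum (f := fun n => ∑ i ∈ s n, a n i ^ p) n)

/-- The moment bound over dyadic families used in the proof of Lemma 3.11
(`lem:weak-integral`): if `E|Z_{n,i}|^p ≤ C^p 2^{-nθp}` for `n ∈ ℕ`,
`1 ≤ i ≤ 2ⁿ`, and `(θ - θ')p > 1`, then
`ξ := sup_{n} max_{1 ≤ i ≤ 2ⁿ} 2^{nθ'} |Z_{n,i}|` satisfies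
`E ξ^p ≤ C^p (1 - 2^{1-(θ-θ')p})⁻¹`; in particular `ξ < ∞` almost surely. -/
theorem dyadic_sup_moment_bound
    (Ω : Type) (m0 : MeasurableSpace Ω) (P : Measure Ω) (hP : IsProbabilityMeasure P)
    (θ θ' p C : ℝ) (hθ' : 0 < θ') (hθ : θ' < θ) (hp : 1 ≤ p)
    (hgap : (θ - θ') * p > 1) (hC : 0 ≤ C)
    (Z : ℕ → ℕ → Ω → ℝ)
    (hmeas : ∀ n i, Measurable (Z n i))
    (hmom : ∀ n : ℕ, ∀ i : ℕ, 1 ≤ i → i ≤ 2 ^ n →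
      ∫⁻ ω, ENNReal.ofReal (|Z n i ω| ^ p) ∂P
        ≤ ENNReal.ofReal (C ^ p * (2 : ℝ) ^ (-(n : ℝ) * θ * p))) :
    (∫⁻ ω, (⨆ (n : ℕ) (i : ℕ) (_ : 1 ≤ i ∧ i ≤ 2 ^ n),
        ENNReal.ofReal ((2 : ℝ) ^ ((n : ℝ) * θ') * |Z n i ω|)) ^ p ∂P
      ≤ ENNReal.ofReal (C ^ p * (1 - (2 : ℝ) ^ (1 - (θ - θ') * p))⁻¹)) ∧
    (∀ᵐ ω ∂P, (⨆ (n : ℕ) (i : ℕ) (_ : 1 ≤ i ∧ i ≤ 2 ^ n),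
        ENNReal.ofReal ((2 : ℝ) ^ ((n : ℝ) * θ') * |Z n i ω|)) < ∞) := by
  have hp0 : 0 < p := by linarith
  set r : ℝ := (2 : ℝ) ^ (1 - (θ - θ') * p) with hr
  have hr0 : 0 ≤ r := by positivity
  have hr1 : r < 1 := Real.rpow_lt_one_of_one_lt_of_neg one_lt_two (by linarith)
  have hterm : ∀ n i : ℕ, i ∈ Finset.Icc 1 (2 ^ n) →
      ∫⁻ ω, ENNReal.ofReal ((2 : ℝ) ^ ((n : ℝ) * θ') * |Z n i ω|) ^ p ∂P ≤
        ENNReal.ofReal ((2 : ℝ) ^ ((n : ℝ) * θ' * p) *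
          (C ^ p * (2 : ℝ) ^ (-(n : ℝ) * θ * p))) := by
    intro n i hi
    rw [Finset.mem_Icc] at hi
    have hpow : ∀ ω, ENNReal.ofReal ((2 : ℝ) ^ ((n : ℝ) * θ') * |Z n i ω|) ^ p =
        ENNReal.ofReal ((2 : ℝ) ^ ((n : ℝ) * θ' * p)) * ENNReal.ofReal (|Z n i ω| ^ p) := by
      intro ω
      rw [ENNReal.ofReal_rpow_of_nonneg (by positivity) hp0.le,
        Real.mul_rpow (by positivity) (abs_nonneg _), ← Real.rpow_mul zero_le_two,
        ENNReal.ofReal_mul (by positivity)]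
    simp_rw [hpow]
    rw [lintegral_const_mul' _ _ ENNReal.ofReal_ne_top, ENNReal.ofReal_mul (by positivity)]
    gcongr
    exact hmom n i hi.1 hi.2
  have hlevel : ∀ n : ℕ,
      ∫⁻ ω, ∑ i ∈ Finset.Icc 1 (2 ^ n),
        ENNReal.ofReal ((2 : ℝ) ^ ((n : ℝ) * θ') * |Z n i ω|) ^ p ∂P ≤
        ENNReal.ofReal (C ^ p * r ^ n) := by
    intro n
    rw [lintegral_finsetSum _ fun i _ => by fun_prop]
    refine (Finset.sum_le_sum (hterm n)).trans_eq ?_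
    rw [← ENNReal.ofReal_sum_of_nonneg fun _ _ => by positivity, Finset.sum_const, Nat.card_Icc,
      Nat.add_sub_cancel, nsmul_eq_mul, Nat.cast_pow, Nat.cast_ofNat]
    congr 1
    have hexp : ((2 : ℝ) ^ n) * ((2 : ℝ) ^ ((n : ℝ) * θ' * p) * (2 : ℝ) ^ (-(n : ℝ) * θ * p)) =
        r ^ n := by
      rw [hr, ← Real.rpow_mul_natCast zero_le_two, ← Real.rpow_natCast,
        ← Real.rpow_add zero_lt_two, ← Real.rpow_add zero_lt_two]
      congr 1
      ring
    rw [← hexp]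
    ring
  have hbound : ∫⁻ ω, (⨆ (n : ℕ) (i : ℕ) (_ : 1 ≤ i ∧ i ≤ 2 ^ n),
        ENNReal.ofReal ((2 : ℝ) ^ ((n : ℝ) * θ') * |Z n i ω|)) ^ p ∂P
      ≤ ENNReal.ofReal (C ^ p * (1 - r)⁻¹) := by
    calc
      _ ≤ ∫⁻ ω, ∑' n : ℕ, ∑ i ∈ Finset.Icc 1 (2 ^ n),
            ENNReal.ofReal ((2 : ℝ) ^ ((n : ℝ) * θ') * |Z n i ω|) ^ p ∂P :=
        lintegral_mono fun ω => iSup_rpow_le_tsum_sum_rpow hp0 _ _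
          (fun _ _ h => Finset.mem_Icc.2 h) _
      _ = ∑' n : ℕ, ∫⁻ ω, ∑ i ∈ Finset.Icc 1 (2 ^ n),
            ENNReal.ofReal ((2 : ℝ) ^ ((n : ℝ) * θ') * |Z n i ω|) ^ p ∂P :=
        lintegral_tsum fun n => by fun_prop
      _ ≤ ∑' n : ℕ, ENNReal.ofReal (C ^ p * r ^ n) := ENNReal.tsum_le_tsum hlevel
      _ = ENNReal.ofReal (C ^ p * (1 - r)⁻¹) := by
        rw [← ENNReal.ofReal_tsum_of_nonneg (fun _ => by positivity)
          ((summable_geometric_of_lt_one hr0 hr1).mul_left _), tsum_mul_left,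
          tsum_geometric_of_lt_one hr0 hr1]
  refine ⟨hbound, ?_⟩
  have hfin := ae_lt_top (by fun_prop) (hbound.trans_lt ENNReal.ofReal_lt_top).ne
  filter_upwards [hfin] with ω hω
  exact (ENNReal.rpow_lt_top_iff_of_pos hp0).1 hω
end
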